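/- arXiv:1802.03747 — 2 statements merged into one kernel-verified Lean document; each statement's English description precedes it below -/
import Mathlib

section
/- Suppose K(r) ≥ k for all r ∈ [0,R], and additionally R ≤ π/√k in case k > 0. If σ(R) = sin_k(R), then σ(r) = sin_k(r) for all r ∈ [0,R]. -/
open Real

/-- The generalized sine function `sin_k`: the solution of `y'' + k y = 0`,
`y 0 = 0`, `y' 0 = 1`. -/
noncomputable def sinK (k r : ℝ) : ℝ :=
  if k = 0 then r
  else if 0 < k then Real.sin (Real.sqrt k * r) / Real.sqrt k
  else Real.sinh (Real.sqrt (-k) * r) / Real.sqrt (-k)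

theorem sinK_exists (k : ℝ) : ∃ c : ℝ → ℝ, (∀ r, HasDerivAt (sinK k) (c r) r) ∧
    (∀ r, HasDerivAt c (-k * sinK k r) r) ∧ c 0 = 1 ∧ sinK k 0 = 0 := by
  rcases lt_trichotomy k 0 with h | h | h
  · have hs : 0 < √(-k) := Real.sqrt_pos.2 (by linarith)
    have hq : √(-k) * √(-k) = -k := Real.mul_self_sqrt (by linarith)
    have e : sinK k = fun r => Real.sinh (√(-k) * r) / √(-k) := by
      funext r; simp [sinK, h.ne, h.not_gt]
    have hl : ∀ r : ℝ, HasDerivAt (fun r => √(-k) * r) (√(-k)) r := fun r => by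
      simpa using (hasDerivAt_id r).const_mul (√(-k))
    refine ⟨fun r => Real.cosh (√(-k) * r), fun r => ?_, fun r => ?_, by simp, by simp [e]⟩
    · rw [e]
      refine ((hl r).sinh.div_const _).congr_deriv ?_
      field_simp
    · rw [e]
      refine (hl r).cosh.congr_deriv ?_
      field_simp
      linear_combination Real.sinh (√(-k) * r) * hq
  · subst h
    have e : sinK 0 = fun r => r := by funext r; simp [sinK]
    refine ⟨fun _ => 1, fun r => ?_, fun r => ?_, rfl, by simp [e]⟩
    · rw [e]; exact hasDerivAt_id r
    · simpa using hasDerivAt_const r (1:ℝ)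
  · have hs : 0 < √k := Real.sqrt_pos.2 h
    have hq : √k * √k = k := Real.mul_self_sqrt h.le
    have e : sinK k = fun r => Real.sin (√k * r) / √k := by
      funext r; simp [sinK, h.ne', h]
    have hl : ∀ r : ℝ, HasDerivAt (fun r => √k * r) (√k) r := fun r => by
      simpa using (hasDerivAt_id r).const_mul (√k)
    refine ⟨fun r => Real.cos (√k * r), fun r => ?_, fun r => ?_, by simp, by simp [e]⟩
    · rw [e]
      refine ((hl r).sin.div_const _).congr_deriv ?_
      field_simp
    · rw [e]
      refine (hl r).cos.congr_deriv ?_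
      field_simp
      linear_combination -Real.sin (√k * r) * hq

theorem sinK_pos (k R : ℝ) (hRk : 0 < k → R ≤ π / √k) (r : ℝ) (h0 : 0 < r) (h1 : r < R) :
    0 < sinK k r := by
  unfold sinK
  split_ifs with h h'
  · exact h0
  · have hs : 0 < √k := Real.sqrt_pos.2 h'
    have := (lt_div_iff₀ hs).1 (h1.trans_le (hRk h'))
    exact div_pos (Real.sin_pos_of_pos_of_lt_pi (by positivity) (by linarith)) hs
  · have hk : k < 0 := lt_of_le_of_ne (not_lt.1 h') h
    have hs : 0 < √(-k) := Real.sqrt_pos.2 (by linarith)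
    exact div_pos (Real.sinh_pos_iff.2 (by positivity)) hs

/-- If `K ≥ k` on `[0,R]` (and `R ≤ π/√k` when `k > 0`) and
`σ(R) = sin_k(R)`, then `σ = sin_k` on `[0,R]`. -/
theorem sigma_eq_sinK_of_eq_at_R
    (R k : ℝ) (hR : 0 < R) (σ σ' σ'' K : ℝ → ℝ)
    (hderiv : ∀ r ∈ Set.Icc 0 R, HasDerivAt σ (σ' r) r)
    (hderiv' : ∀ r ∈ Set.Icc 0 R, HasDerivAt σ' (σ'' r) r)
    (hcont : ContinuousOn σ'' (Set.Icc 0 R))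
    (hσ0 : σ 0 = 0) (hσ'0 : σ' 0 = 1)
    (hσpos : ∀ r ∈ Set.Ioc 0 R, 0 < σ r)
    (hODE : ∀ r ∈ Set.Icc 0 R, σ'' r + K r * σ r = 0)    (hk : ∀ r ∈ Set.Icc 0 R, k ≤ K r)
    (hRk : 0 < k → R ≤ π / Real.sqrt k)
    (heq : σ R = sinK k R) :
    ∀ r ∈ Set.Icc 0 R, σ r = sinK k r := by
  obtain ⟨c, hs, hc, hc0, hs0⟩ := sinK_exists k
  have hspos : ∀ r ∈ Set.Ioc 0 R, 0 < sinK k r := by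
    intro r hr
    rcases hr.2.lt_or_eq with h | h
    · exact sinK_pos k R hRk r hr.1 h
    · rw [h, ← heq]; exact hσpos R ⟨hR, le_rfl⟩
  have hW : ∀ r ∈ Set.Icc 0 R, HasDerivAt (fun r => σ' r * sinK k r - σ r * c r)
      ((k - K r) * (σ r * sinK k r)) r := by
    intro r hr
    refine (((hderiv' r hr).mul (hs r)).sub ((hderiv r hr).mul (hc r))).congr_deriv ?_
    have : σ'' r = - (K r * σ r) := by linarith [hODE r hr]
    rw [this]; ring
  have hWanti : AntitoneOn (fun r => σ' r * sinK k r - σ r * c r) (Set.Icc 0 R) := by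
    refine antitoneOn_of_hasDerivWithinAt_nonpos (convex_Icc 0 R)
      (fun r hr => (hW r hr).continuousAt.continuousWithinAt)
      (fun r hr => (hW r (interior_subset hr)).hasDerivWithinAt) ?_
    intro r hr
    rw [interior_Icc] at hr
    have h1 := hσpos r ⟨hr.1, hr.2.le⟩
    have h2 := hspos r ⟨hr.1, hr.2.le⟩
    have h3 := hk r ⟨hr.1.le, hr.2.le⟩
    exact mul_nonpos_of_nonpos_of_nonneg (by linarith) (by positivity)
  have hWle : ∀ r ∈ Set.Icc 0 R, σ' r * sinK k r - σ r * c r ≤ 0 := by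
    intro r hr
    have := hWanti ⟨le_rfl, hR.le⟩ hr hr.1
    simpa [hs0, hσ0] using this
  have hq : ∀ r ∈ Set.Ioc 0 R, HasDerivAt (fun r => σ r / sinK k r)
      ((σ' r * sinK k r - σ r * c r) / sinK k r ^ 2) r := fun r hr =>
    (hderiv r ⟨hr.1.le, hr.2⟩).div (hs r) (hspos r hr).ne'
  have hqanti : AntitoneOn (fun r => σ r / sinK k r) (Set.Ioc 0 R) := by
    refine antitoneOn_of_hasDerivWithinAt_nonpos (convex_Ioc 0 R)
      (fun r hr => (hq r hr).continuousAt.continuousWithinAt)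
      (fun r hr => (hq r (interior_subset hr)).hasDerivWithinAt) ?_
    intro r hr
    have hr' := interior_subset hr
    exact div_nonpos_of_nonpos_of_nonneg (hWle r ⟨hr'.1.le, hr'.2⟩) (sq_nonneg _)
  intro r hr
  rcases hr.1.eq_or_lt with h | h
  · rw [← h, hσ0, hs0]
  have hr' : r ∈ Set.Ioc 0 R := ⟨h, hr.2⟩
  have hsr := hspos r hr'
  apply le_antisymm
  · have hd : HasDerivAt (fun y => σ y * sinK k r - σ r * sinK k y)
        (σ' 0 * sinK k r - σ r * c 0) 0 :=
      ((hderiv 0 ⟨le_rfl, hR.le⟩).mul_const _).sub ((hs 0).const_mul _)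
    have ht := hd.tendsto_slope_zero_right
    have hge := ge_of_tendsto (b := 0) ht (by
      filter_upwards [Ioc_mem_nhdsGT h] with y hy
      have hyR : y ∈ Set.Ioc 0 R := ⟨hy.1, hy.2.trans hr.2⟩
      have h1 : σ r / sinK k r ≤ σ y / sinK k y := hqanti hyR hr' hy.2
      rw [div_le_div_iff₀ hsr (hspos y hyR)] at h1
      have hy0 := hy.1
      simp only [zero_add, hσ0, hs0, zero_mul, mul_zero, sub_zero, smul_eq_mul]
      exact mul_nonneg (inv_nonneg.2 hy0.le) (by linarith))
    rw [hσ'0, hc0] at hge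
    linarith
  · have h1 : σ R / sinK k R ≤ σ r / sinK k r := hqanti hr' ⟨hR, le_rfl⟩ hr.2
    rw [heq, div_self (hspos R ⟨hR, le_rfl⟩).ne', le_div_iff₀ hsr] at h1
    linarith
end

section
/- Suppose K(r) ≥ k for all r ∈ [0,R], and additionally R ≤ π/√k in case k > 0. Then for every natural number n ≥ 2, every r ∈ (0,R], and all real numbers A ≥ 0 and B ≥ 0, one has (A + B/σ(r)²)·σ(r)^(n−1) ≥ (σ(R)/sin_k(R))^(n−1) · (A + B/sin_k(r)²)·sin_k(r)^(n−1). -/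
open Real

theorem sinK_ode (k : ℝ) : ∃ c : ℝ → ℝ, (∀ r, HasDerivAt (sinK k) (c r) r) ∧
    (∀ r, HasDerivAt c (-k * sinK k r) r) ∧ sinK k 0 = 0 ∧ c 0 = 1 := by
  rcases lt_trichotomy k 0 with h | h | h
  · have hs : 0 < Real.sqrt (-k) := Real.sqrt_pos.2 (by linarith)
    have hsq : Real.sqrt (-k) * Real.sqrt (-k) = -k := Real.mul_self_sqrt (by linarith)
    have e : sinK k = fun r => Real.sinh (Real.sqrt (-k) * r) / Real.sqrt (-k) := by
      funext r; simp [sinK, h.ne, not_lt.2 h.le]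
    rw [e]
    refine ⟨fun r => Real.cosh (Real.sqrt (-k) * r), fun r => ?_, fun r => ?_, by simp, by simp⟩
    · have := (((hasDerivAt_id r).const_mul (Real.sqrt (-k))).sinh).div_const (Real.sqrt (-k))
      refine this.congr_deriv ?_
      simp only [id]; field_simp
    · have := (((hasDerivAt_id r).const_mul (Real.sqrt (-k))).cosh)
      refine this.congr_deriv ?_
      generalize Real.sqrt (-k) = q at *
      rw [← hsq]
      simp only [id]; field_simp
  · have e : sinK k = fun r => r := by
      funext r; simp [sinK, h]
    rw [e]
    refine ⟨fun r => 1, fun r => hasDerivAt_id r, fun r => ?_, by simp, by simp⟩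
    simpa [h] using hasDerivAt_const r (1:ℝ)
  · have hs : 0 < Real.sqrt k := Real.sqrt_pos.2 h
    have hsq : Real.sqrt k * Real.sqrt k = k := Real.mul_self_sqrt h.le
    have e : sinK k = fun r => Real.sin (Real.sqrt k * r) / Real.sqrt k := by
      funext r; simp [sinK, h.ne', h]
    rw [e]
    refine ⟨fun r => Real.cos (Real.sqrt k * r), fun r => ?_, fun r => ?_, by simp, by simp⟩
    · have := (((hasDerivAt_id r).const_mul (Real.sqrt k)).sin).div_const (Real.sqrt k)
      refine this.congr_deriv ?_
      simp only [id]; field_simp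
    · have := (((hasDerivAt_id r).const_mul (Real.sqrt k)).cos)
      refine this.congr_deriv ?_
      have h2 : -k = -(Real.sqrt k * Real.sqrt k) := by rw [hsq]
      rw [h2]
      simp only [id]; field_simp

theorem sinK_pos_s14 (k r : ℝ) (hr : 0 < r) (h : 0 < k → r < π / Real.sqrt k) : 0 < sinK k r := by
  unfold sinK
  split_ifs with h0 h1
  · exact hr
  · have hs : 0 < Real.sqrt k := Real.sqrt_pos.2 h1
    refine div_pos (Real.sin_pos_of_pos_of_lt_pi (by positivity) ?_) hs
    have := (lt_div_iff₀ hs).1 (h h1)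
    linarith
  · have hs : 0 < Real.sqrt (-k) :=
      Real.sqrt_pos.2 (by rcases lt_or_gt_of_ne h0 with h | h <;> [linarith; exact absurd h h1])
    exact div_pos (Real.sinh_pos_iff.2 (by positivity)) hs

/-- Pointwise integrand comparison: if `K ≥ k` on `[0,R]` (and `R ≤ π/√k`
when `k > 0`), then for `n ≥ 2`, `r ∈ (0,R]`, and `A, B ≥ 0`,
`(A + B/σ(r)²)·σ(r)^(n−1) ≥ (σ(R)/sin_k(R))^(n−1)·(A + B/sin_k(r)²)·sin_k(r)^(n−1)`. -/
theorem integrand_lower_bound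
    (R k : ℝ) (hR : 0 < R) (σ σ' σ'' K : ℝ → ℝ)
    (hderiv : ∀ r ∈ Set.Icc 0 R, HasDerivAt σ (σ' r) r)
    (hderiv' : ∀ r ∈ Set.Icc 0 R, HasDerivAt σ' (σ'' r) r)
    (hcont : ContinuousOn σ'' (Set.Icc 0 R))
    (hσ0 : σ 0 = 0) (hσ'0 : σ' 0 = 1)
    (hσpos : ∀ r ∈ Set.Ioc 0 R, 0 < σ r)
    (hODE : ∀ r ∈ Set.Icc 0 R, σ'' r + K r * σ r = 0)    (hk : ∀ r ∈ Set.Icc 0 R, k ≤ K r)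
    (hRk : 0 < k → R ≤ π / Real.sqrt k) :
    ∀ n : ℕ, 2 ≤ n → ∀ r ∈ Set.Ioc 0 R, ∀ A B : ℝ, 0 ≤ A → 0 ≤ B →
      (σ R / sinK k R) ^ (n - 1) * ((A + B / sinK k r ^ 2) * sinK k r ^ (n - 1))
        ≤ (A + B / σ r ^ 2) * σ r ^ (n - 1) := by
  intro n hn r hr A B hA hB
  by_cases hend : 0 < k ∧ R = π / Real.sqrt k
  · obtain ⟨hk0, hRe⟩ := hend
    have hs : 0 < Real.sqrt k := Real.sqrt_pos.2 hk0
    have h0 : sinK k R = 0 := by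
      have : Real.sqrt k * (π / Real.sqrt k) = π := by field_simp
      simp [sinK, hk0.ne', hk0, hRe, this]
    have hp := hσpos r hr
    rw [h0, div_zero, zero_pow (by omega), zero_mul]
    positivity
  have hlt : 0 < k → R < π / Real.sqrt k := fun h =>
    lt_of_le_of_ne (hRk h) (fun h' => hend ⟨h, h'⟩)
  have spos : ∀ t ∈ Set.Ioc 0 R, 0 < sinK k t := fun t ht =>
    sinK_pos_s14 k t ht.1 (fun h => ht.2.trans_lt (hlt h))
  obtain ⟨c, hs', hc', hs0, hc0⟩ := sinK_ode k
  generalize sinK k = s at *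
  -- Wronskian
  have hW : ∀ t ∈ Set.Icc 0 R, HasDerivAt (fun t => σ' t * s t - σ t * c t)
      ((k - K t) * (σ t * s t)) t := by
    intro t ht
    refine (((hderiv' t ht).mul (hs' t)).sub ((hderiv t ht).mul (hc' t))).congr_deriv ?_
    have := hODE t ht
    have e : σ'' t = -(K t * σ t) := by linarith
    rw [e]; ring
  have hWanti : AntitoneOn (fun t => σ' t * s t - σ t * c t) (Set.Icc 0 R) := by
    refine antitoneOn_of_deriv_nonpos (convex_Icc 0 R)
      (fun t ht => (hW t ht).continuousAt.continuousWithinAt)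
      (fun t ht => (hW t (interior_subset ht)).differentiableAt.differentiableWithinAt) ?_
    intro t ht
    rw [(hW t (interior_subset ht)).deriv]
    rw [interior_Icc] at ht
    have ht' : t ∈ Set.Ioc 0 R := ⟨ht.1, ht.2.le⟩
    have := mul_pos (hσpos t ht') (spos t ht')
    have h2 := hk t ⟨ht.1.le, ht.2.le⟩
    exact mul_nonpos_of_nonpos_of_nonneg (by linarith) this.le
  have hWle : ∀ t ∈ Set.Icc 0 R, σ' t * s t - σ t * c t ≤ 0 := by
    intro t ht
    have := hWanti ⟨le_rfl, hR.le⟩ ht ht.1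
    simpa [hσ0, hs0] using this
  have hq : ∀ t ∈ Set.Ioc 0 R, HasDerivAt (fun t => σ t / s t)
      ((σ' t * s t - σ t * c t) / s t ^ 2) t := fun t ht =>
    (hderiv t ⟨ht.1.le, ht.2⟩).div (hs' t) (spos t ht).ne'
  have hqanti : AntitoneOn (fun t => σ t / s t) (Set.Ioc 0 R) := by
    refine antitoneOn_of_deriv_nonpos (convex_Ioc 0 R)
      (fun t ht => (hq t ht).continuousAt.continuousWithinAt)
      (fun t ht => (hq t (interior_subset ht)).differentiableAt.differentiableWithinAt) ?_
    intro t ht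
    have ht' : t ∈ Set.Ioc 0 R := interior_subset ht
    rw [(hq t ht').deriv]
    exact div_nonpos_of_nonpos_of_nonneg (hWle t ⟨ht'.1.le, ht'.2⟩) (sq_nonneg _)
  have hsr := spos r hr
  have hσr := hσpos r hr
  have hqR : σ R / s R ≤ σ r / s r := hqanti hr ⟨hR, le_rfl⟩ hr.2
  have hle : σ r ≤ s r := by
    have l1 := (hderiv 0 ⟨le_rfl, hR.le⟩).tendsto_slope_zero_right
    have l2 := (hs' 0).tendsto_slope_zero_right
    simp only [zero_add, hσ0, hs0, hσ'0, hc0, sub_zero, smul_eq_mul] at l1 l2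
    have l3 := l2.const_mul (σ r / s r)
    have hfin : σ r / s r * 1 ≤ 1 := by
      refine le_of_tendsto_of_tendsto l3 l1 ?_
      filter_upwards [Ioo_mem_nhdsGT hr.1] with t ht
      have ht' : t ∈ Set.Ioc 0 R := ⟨ht.1, ht.2.le.trans hr.2⟩
      have h1 : σ r / s r ≤ σ t / s t := hqanti ht' hr ht.2.le
      rw [le_div_iff₀ (spos t ht')] at h1
      have := mul_le_mul_of_nonneg_left h1 (inv_pos.2 ht.1).le
      linarith
    rw [mul_one, div_le_one hsr] at hfin
    exact hfin
  have hRpos : 0 ≤ σ R / s R :=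
    (div_pos (hσpos R ⟨hR, le_rfl⟩) (spos R ⟨hR, le_rfl⟩)).le
  calc (σ R / s R) ^ (n - 1) * ((A + B / s r ^ 2) * s r ^ (n - 1))
      ≤ (σ r / s r) ^ (n - 1) * ((A + B / s r ^ 2) * s r ^ (n - 1)) := by gcongr
    _ = (A + B / s r ^ 2) * σ r ^ (n - 1) := by
        rw [div_pow]
        have : s r ^ (n - 1) ≠ 0 := (pow_pos hsr _).ne'
        generalize s r ^ (n - 1) = x at *
        field_simp
    _ ≤ (A + B / σ r ^ 2) * σ r ^ (n - 1) := by gcongr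
end
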